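/- Under the same hypotheses as the upper-tail product-state bound, for every real a ≥ √(8em²/n), the weight Tr(ρ Π_{≤ ⟨H⟩_ρ − na}) of ρ on eigenvalues of H at most ⟨H⟩_ρ − na is at most exp(−na²/(4em²)). -/

import Mathlib

open Matrix
open scoped ComplexOrder

variable {C : Type*} [Fintype C] [DecidableEq C] {d : ℕ}

/-- An operator on the spins `C` (each carrying `ℂ^d`) is *supported on* the
subset `w ⊆ C` if it acts as the identity on the tensor factors outside `w`:
its matrix entries vanish unless the configurations agree outside `w`, and they
depend only on the configuration inside `w`. -/
def SupportedOn (w : Finset C) (M : Matrix (C → Fin d) (C → Fin d) ℂ) : Prop :=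
  (∀ x y, M x y ≠ 0 → ∀ s ∉ w, x s = y s) ∧
  (∀ x y x' y', (∀ s ∈ w, x s = x' s) → (∀ s ∈ w, y s = y' s) →
    (∀ s ∉ w, x s = y s) → (∀ s ∉ w, x' s = y' s) → M x y = M x' y')

/-- The product operator `⊗_{s ∈ C} ρ_s` on `⊗_{s ∈ C} ℂ^d`. -/
def prodMatrix (ρs : C → Matrix (Fin d) (Fin d) ℂ) :
    Matrix (C → Fin d) (C → Fin d) ℂ :=
  fun x y => ∏ s, ρs s (x s) (y s)

/-- Operator (spectral) norm of a matrix. -/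
noncomputable def opNorm {m : Type*} [Fintype m] [DecidableEq m]
    (M : Matrix m m ℂ) : ℝ :=
  ‖Matrix.toEuclideanCLM (𝕜 := ℂ) M‖

/-- Spectral projector of a Hermitian matrix `H` onto eigenvalues ≥ `f`. -/
noncomputable def projGE {m : Type*} [Fintype m] [DecidableEq m]
    {H : Matrix m m ℂ} (hH : H.IsHermitian) (f : ℝ) : Matrix m m ℂ :=
  (hH.eigenvectorUnitary : Matrix m m ℂ) *
    Matrix.diagonal (fun i => if f ≤ hH.eigenvalues i then (1 : ℂ) else 0) *
    (star hH.eigenvectorUnitary : Matrix m m ℂ)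

/-- Spectral projector of a Hermitian matrix `H` onto eigenvalues ≤ `f`. -/
noncomputable def projLE {m : Type*} [Fintype m] [DecidableEq m]
    {H : Matrix m m ℂ} (hH : H.IsHermitian) (f : ℝ) : Matrix m m ℂ :=
  (hH.eigenvectorUnitary : Matrix m m ℂ) *
    Matrix.diagonal (fun i => if hH.eigenvalues i ≤ f then (1 : ℂ) else 0) *
    (star hH.eigenvectorUnitary : Matrix m m ℂ)

section Combinatorics
open Finset

/-- Alternating sum of a set function. -/
def altSum {ι M : Type*} [DecidableEq ι] [AddCommGroup M] (F : Finset ι → M) (A : Finset ι) : M :=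
  ∑ B ∈ A.powerset, (-1 : ℤ) ^ (#A + #B) • F B

section
variable {ι M : Type*} [DecidableEq ι] [AddCommGroup M]

lemma altSum_empty (F : Finset ι → M) : altSum F ∅ = F ∅ := by simp [altSum]

lemma altSum_insert (F : Finset ι → M) {A : Finset ι} {u : ι} (hu : u ∉ A) :
    altSum F (insert u A) = altSum (fun B => F (insert u B)) A - altSum F A := by
  unfold altSum
  rw [Finset.sum_powerset_insert hu, add_comm, sub_eq_add_neg, ← Finset.sum_neg_distrib]
  congr 1
  · refine Finset.sum_congr rfl fun B hB => ?_
    have hB' : u ∉ B := fun h => hu (Finset.mem_powerset.1 hB h)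
    rw [Finset.card_insert_of_notMem hu, Finset.card_insert_of_notMem hB',
      show #A + 1 + (#B + 1) = #A + #B + 2 by ring, pow_add]
    simp
  · refine Finset.sum_congr rfl fun B hB => ?_
    rw [Finset.card_insert_of_notMem hu, show #A + 1 + #B = #A + #B + 1 by ring, pow_succ]
    simp

lemma altSum_singleton (F : Finset ι → M) (u : ι) : altSum F {u} = F {u} - F ∅ := by
  simpa [altSum_empty] using altSum_insert F (Finset.notMem_empty u)

lemma altSum_congr {F G : Finset ι → M} {A : Finset ι} (h : ∀ B ⊆ A, F B = G B) :
    altSum F A = altSum G A :=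
  Finset.sum_congr rfl fun B hB => by rw [h B (Finset.mem_powerset.1 hB)]

lemma map_altSum {N F : Type*} [AddCommGroup N] [FunLike F M N] [AddMonoidHomClass F M N]
    (f : F) (G : Finset ι → M) (A : Finset ι) :
    f (altSum G A) = altSum (fun B => f (G B)) A := by
  simp [altSum, map_sum, map_zsmul]

lemma altSum_pow_card {R : Type*} [CommRing R] (c : R) (A : Finset ι) :
    altSum (fun B => c ^ #B) A = (c - 1) ^ #A := by
  induction A using Finset.induction_on with
  | empty => simp [altSum_empty]
  | insert u A hu ih =>
    rw [altSum_insert _ hu, Finset.card_insert_of_notMem hu, ih,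
      altSum_congr (G := fun B => AddMonoidHom.mulLeft c (c ^ #B)), ← map_altSum, ih]
    · simp; ring
    · intro B hB
      simp [Finset.card_insert_of_notMem fun h => hu (hB h), pow_succ']

lemma altSum_sum_pow_succ {R : Type*} [Ring R] (x : ι → R) (r : ℕ) (A : Finset ι) :
    altSum (fun B => (∑ w ∈ B, x w) ^ (r + 1)) A =
      ∑ w ∈ A, x w * (altSum (fun B => (∑ w ∈ B, x w) ^ r) A +
        altSum (fun B => (∑ w ∈ B, x w) ^ r) (A.erase w)) := by
  set F : Finset ι → R := fun B => (∑ w ∈ B, x w) ^ r with hF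
  have h1 : altSum (fun B => (∑ w ∈ B, x w) ^ (r + 1)) A =
      ∑ w ∈ A, altSum (fun B => if w ∈ B then x w * F B else 0) A := by
    unfold altSum
    rw [Finset.sum_comm]
    refine Finset.sum_congr rfl fun B hB => ?_
    rw [← Finset.smul_sum, ← Finset.sum_filter, Finset.filter_mem_eq_inter,
      Finset.inter_eq_right.2 (Finset.mem_powerset.1 hB), ← Finset.sum_mul]
    simp only [hF, pow_succ']
  rw [h1]
  refine Finset.sum_congr rfl fun w hw => ?_
  have hA : A = insert w (A.erase w) := (Finset.insert_erase hw).symm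
  have hw' : w ∉ A.erase w := Finset.notMem_erase w A
  have h2 : altSum F A = altSum (fun B => F (insert w B)) (A.erase w) - altSum F (A.erase w) := by
    conv_lhs => rw [hA]
    exact altSum_insert F hw'
  rw [h2, sub_add_cancel]
  conv_lhs => rw [hA]
  rw [altSum_insert _ hw', altSum_congr (G := fun B => AddMonoidHom.mulLeft (x w) (F (insert w B))),
    ← map_altSum, altSum_congr (F := fun B => if w ∈ B then x w * F B else 0)
      (G := fun B => AddMonoidHom.mulLeft (0 : R) (F B)), ← map_altSum]
  · simp
  · intro B hB
    simp [show w ∉ B from fun h => hw' (hB h)]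
  · intro B hB
    simp

end


theorem norm_le_pow_card_of_altSum_le {ι : Type*} [DecidableEq ι] (M : Finset ι → ℂ)
    (adj : ι → ι → Prop) [DecidableRel adj] (hsymm : ∀ a b, adj a b → adj b a)
    (W : Finset ι) (m : ℕ) (hdeg : ∀ w ∈ W, #{s ∈ W | adj w s} ≤ m)
    (hM0 : M ∅ = 1)
    (hfac : ∀ A ⊆ W, ∀ S ⊆ W, Disjoint A S → (∀ a ∈ A, ∀ s ∈ S, ¬ adj a s) →
      M (A ∪ S) = M A * M S)
    {y z β κ : ℝ} (hz : 0 ≤ z) (hzy : z ≤ y) (hβ : 0 ≤ β) (hκ : 1 ≤ κ)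
    (hyβ : y * (1 + β) ^ (m - 1) ≤ β) (hyκ : 1 + (y * (1 + β) ^ m - z) / 4 ≤ κ)
    (hΔ : ∀ A ⊆ W, A.Nonempty → ‖altSum M A‖ ≤ (y ^ #A - if #A = 1 then z else 0) / 4)
    {S : Finset ι} (hS : S ⊆ W) : ‖M S‖ ≤ κ ^ #S := by
  have hy : 0 ≤ y := hz.trans hzy
  have key : ∀ (n : ℕ) (S A : Finset ι), #S = n → A.Nonempty → Disjoint A S → A ⊆ W → S ⊆ W →
      (∀ S' ⊆ S, ‖M S'‖ ≤ κ ^ #S') →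
      ‖altSum (fun B => M (B ∪ S)) A‖ ≤
        (y ^ #A * (1 + β) ^ #{s ∈ S | ∃ a ∈ A, adj a s} - if #A = 1 then z else 0) / 4 * κ ^ #S := by
    intro n
    induction n with
    | zero =>
      intro S A hS hA _ hAW _ _
      obtain rfl := Finset.card_eq_zero.1 hS
      simpa using hΔ A hAW hA
    | succ n ih =>
      intro S A hSn hA hd hAW hSW hb
      by_cases hf : ∃ u ∈ S, ∃ a ∈ A, adj a u
      · obtain ⟨u, huS, a, haA, hau⟩ := hf
        have huA : u ∉ A := fun h => Finset.disjoint_left.1 hd h huS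
        set T := S.erase u with hT
        have hST : S = insert u T := (Finset.insert_erase huS).symm
        have huT : u ∉ T := Finset.notMem_erase u S
        have hTS : T ⊆ S := Finset.erase_subset _ _
        have hTn : #T = n := by rw [hT, Finset.card_erase_of_mem huS, hSn]; rfl
        have e : altSum (fun B => M (B ∪ S)) A =
            altSum (fun B => M (B ∪ T)) A + altSum (fun B => M (B ∪ T)) (insert u A) := by
          rw [altSum_insert _ huA, add_sub_cancel]
          refine altSum_congr fun B _ => ?_
          rw [hST, Finset.union_insert, Finset.insert_union]
        have i1 := ih T A hTn hA (hd.mono_right hTS) hAW (hTS.trans hSW)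
          fun S' h => hb S' (h.trans hTS)
        have i2 := ih T (insert u A) hTn (Finset.insert_nonempty _ _)
          (by rw [Finset.disjoint_insert_left]; exact ⟨huT, hd.mono_right hTS⟩)
          (Finset.insert_subset (hSW huS) hAW) (hTS.trans hSW) fun S' h => hb S' (h.trans hTS)
        set f := #{s ∈ T | ∃ a ∈ A, adj a s} with hfdef
        have hf1 : #{s ∈ S | ∃ a ∈ A, adj a s} = f + 1 := by
          rw [hST, Finset.filter_insert, if_pos ⟨a, haA, hau⟩, Finset.card_insert_of_notMem]
          simp [huT]
        have hf2 : #{s ∈ T | ∃ b ∈ insert u A, adj b s} ≤ f + (m - 1) := by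
          have h1 : #{s ∈ T | adj u s} ≤ m - 1 := by
            have h2 : {s ∈ T | adj u s} ⊆ ({s ∈ W | adj u s}).erase a := by
              intro s hs
              rw [Finset.mem_filter] at hs
              rw [Finset.mem_erase, Finset.mem_filter]
              refine ⟨?_, hSW (hTS hs.1), hs.2⟩
              rintro rfl
              exact Finset.disjoint_left.1 hd haA (hTS hs.1)
            have h3 := Finset.card_le_card h2
            rw [Finset.card_erase_of_mem (Finset.mem_filter.2 ⟨hAW haA, hsymm _ _ hau⟩)] at h3
            exact h3.trans (Nat.sub_le_sub_right (hdeg u (hSW huS)) 1)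
          refine le_trans (Finset.card_le_card (t := {s ∈ T | ∃ a ∈ A, adj a s} ∪ {s ∈ T | adj u s})
            ?_) ((Finset.card_union_le _ _).trans (by omega))
          intro s hs
          simp only [Finset.mem_filter, Finset.mem_union, Finset.mem_insert, exists_eq_or_imp] at hs ⊢
          exact hs.2.elim (fun h => Or.inr ⟨hs.1, h⟩) fun h => Or.inl ⟨hs.1, h⟩
        have hcard : #(insert u A) = #A + 1 := Finset.card_insert_of_notMem huA
        have hA1 : 1 ≤ #A := hA.card_pos
        rw [hcard, if_neg (by omega : ¬ #A + 1 = 1), sub_zero] at i2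
        have hP : (0 : ℝ) ≤ y ^ #A * (1 + β) ^ f := by positivity
        have i3 : y ^ (#A + 1) * (1 + β) ^ #{s ∈ T | ∃ b ∈ insert u A, adj b s} ≤
            y ^ #A * (1 + β) ^ f * β := by
          calc _ ≤ y ^ (#A + 1) * (1 + β) ^ (f + (m - 1)) := by
                gcongr
                linarith
            _ = y ^ #A * (1 + β) ^ f * (y * (1 + β) ^ (m - 1)) := by ring
            _ ≤ _ := by gcongr
        have hc : (if #A = 1 then z else 0) ≤ y ^ #A * (1 + β) ^ (f + 1) := by
          split_ifs with h
          · rw [h, pow_one]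
            exact hzy.trans (le_mul_of_one_le_right hy (one_le_pow₀ (by linarith)))
          · positivity
        have hκn : κ ^ #T ≤ κ ^ #S := pow_le_pow_right₀ hκ (Finset.card_le_card hTS)
        have hκ0 : 0 ≤ κ ^ #T := by positivity
        rw [e, hf1]
        calc _ ≤ _ := norm_add_le _ _
          _ ≤ _ := add_le_add i1 i2
          _ ≤ (y ^ #A * (1 + β) ^ (f + 1) - if #A = 1 then z else 0) / 4 * κ ^ #T := by
              rw [← add_mul]
              refine mul_le_mul_of_nonneg_right ?_ hκ0
              have h5 : y ^ #A * (1 + β) ^ (f + 1) =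
                  y ^ #A * (1 + β) ^ f + y ^ #A * (1 + β) ^ f * β := by ring
              linarith
          _ ≤ _ := by
              refine mul_le_mul_of_nonneg_left hκn ?_
              linarith
      · push Not at hf
        have h0 : #{s ∈ S | ∃ a ∈ A, adj a s} = 0 := by
          rw [Finset.card_eq_zero, Finset.filter_eq_empty_iff]
          rintro s hs ⟨a, ha, h⟩
          exact hf s hs a ha h
        rw [h0, pow_zero, mul_one,
          altSum_congr (G := fun B => AddMonoidHom.mulRight (M S) (M B)), ← map_altSum]
        · rw [AddMonoidHom.coe_mulRight, norm_mul]
          exact mul_le_mul (hΔ A hAW hA) (hb S subset_rfl) (norm_nonneg _)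
            ((norm_nonneg _).trans (hΔ A hAW hA))
        · intro B hB
          exact hfac B (hB.trans hAW) S hSW (hd.mono_left hB) fun a ha s hs => hf s hs a (hB ha)
  induction S using Finset.strongInduction with
  | H S ih =>
    rcases S.eq_empty_or_nonempty with rfl | ⟨v, hv⟩
    · simp [hM0]
    · set T := S.erase v with hT
      have hST : S = insert v T := (Finset.insert_erase hv).symm
      have hvT : v ∉ T := Finset.notMem_erase v S
      have hTS : T ⊂ S := Finset.erase_ssubset hv
      have h1 := key _ T {v} rfl (Finset.singleton_nonempty v) (by simpa using hvT)
        (by simpa using hS hv) (hTS.subset.trans hS)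
        fun S' h => ih S' (h.trans_ssubset hTS) (h.trans (hTS.subset.trans hS))
      have e : M S = M T + altSum (fun B => M (B ∪ T)) {v} := by
        rw [altSum_singleton, Finset.empty_union, ← Finset.insert_eq, ← hST, add_sub_cancel]
      have h2 := ih T hTS (hTS.subset.trans hS)
      have h3 : #{s ∈ T | ∃ a ∈ ({v} : Finset ι), adj a s} ≤ m := by
        refine le_trans (Finset.card_le_card ?_) (hdeg v (hS hv))
        intro s hs
        simp only [Finset.mem_filter, Finset.mem_singleton, exists_eq_left] at hs ⊢
        exact ⟨hS (hTS.subset hs.1), hs.2⟩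
      have h4 : y * (1 + β) ^ #{s ∈ T | ∃ a ∈ ({v} : Finset ι), adj a s} ≤ y * (1 + β) ^ m := by
        gcongr
        linarith
      have hκ0 : 0 ≤ κ ^ #T := by positivity
      simp only [Finset.card_singleton, pow_one, if_true] at h1
      rw [hST, Finset.card_insert_of_notMem hvT, ← hST, e]
      calc _ ≤ _ := norm_add_le _ _
        _ ≤ _ := add_le_add h2 h1
        _ ≤ κ ^ #T * κ := by nlinarith
        _ = _ := (pow_succ _ _).symm


section
variable {ι : Type*} [DecidableEq ι]

lemma altSum_const {M : Type*} [AddCommGroup M] (c : M) {A : Finset ι} (hA : A.Nonempty) :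
    altSum (fun _ => c) A = 0 := by
  obtain ⟨u, hu⟩ := hA
  rw [← Finset.insert_erase hu, altSum_insert _ (Finset.notMem_erase u A), sub_self]

lemma hasSum_altSum {M : Type*} [NormedAddCommGroup M] {f : Finset ι → ℕ → M} {g : Finset ι → M}
    (h : ∀ B, HasSum (f B) (g B)) (A : Finset ι) :
    HasSum (fun r => altSum (fun B => f B r) A) (altSum g A) := by
  unfold altSum
  refine hasSum_sum fun B _ => ?_
  exact (h B).map (zsmulAddGroupHom ((-1 : ℤ) ^ (#A + #B)) : M →+ M) (continuous_zsmul _)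

lemma altSum_sum_pow_nonneg (x : ι → ℝ) (hx : ∀ i, 0 ≤ x i) (r : ℕ) (A : Finset ι) :
    0 ≤ altSum (fun B => (∑ w ∈ B, x w) ^ r) A := by
  induction r generalizing A with
  | zero =>
    rcases A.eq_empty_or_nonempty with rfl | hA
    · simp [altSum_empty]
    · simp [altSum_const _ hA]
  | succ r ih =>
    rw [altSum_sum_pow_succ]
    exact Finset.sum_nonneg fun w _ => mul_nonneg (hx w) (add_nonneg (ih _) (ih _))

theorem norm_altSum_exp_le {R E : Type*} [NormedRing R] [NormedAlgebra ℂ R] [CompleteSpace R]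
    [NormedAddCommGroup E] [NormedSpace ℂ E] (Φ : R →ₗ[ℂ] E) (φ : R →L[ℂ] ℂ) (x : ι → R)
    {A : Finset ι} (hA : A.Nonempty)
    (hφ1 : ∀ w ∈ A, φ (x w) = 0) (hφ : ∀ w ∈ A, ∀ X, ‖φ (x w * X)‖ ≤ ‖Φ X‖)
    (hΦ1 : ∀ w ∈ A, ‖Φ (x w)‖ ≤ 1) (hΦ : ∀ w ∈ A, ∀ X, ‖Φ (x w * X)‖ ≤ 2 * ‖Φ X‖)
    {t : ℝ} (ht : 0 ≤ t) :
    ‖altSum (fun B => φ (NormedSpace.exp ((-t : ℂ) • ∑ w ∈ B, x w))) A‖ ≤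
      ((Real.exp (2 * t) - 1) ^ #A - if #A = 1 then 2 * t else 0) / 4 := by
  set D : ℕ → Finset ι → R := fun r A => altSum (fun B => (∑ w ∈ B, x w) ^ r) A with hD
  set Q : ℕ → Finset ι → ℝ := fun r A => altSum (fun B => (∑ _w ∈ B, (2 : ℝ)) ^ r) A with hQ
  have hDs : ∀ r A, D (r + 1) A = ∑ w ∈ A, x w * (D r A + D r (A.erase w)) :=
    fun r A => altSum_sum_pow_succ x r A
  have hQs : ∀ r A, Q (r + 1) A = ∑ w ∈ A, 2 * (Q r A + Q r (A.erase w)) :=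
    fun r A => altSum_sum_pow_succ (fun _ => (2 : ℝ)) r A
  have hQ0 : ∀ r A, 0 ≤ Q r A := altSum_sum_pow_nonneg _ fun _ => by norm_num
  have hD0 : ∀ A : Finset ι, A.Nonempty → D 0 A = 0 := fun A hA => by
    simp [hD, altSum_const _ hA]
  have hQ00 : ∀ A : Finset ι, A.Nonempty → Q 0 A = 0 := fun A hA => by
    simp [hQ, altSum_const _ hA]
  have hD0' : D 0 ∅ = 1 := by simp [hD, altSum_empty]
  have hQ0' : Q 0 ∅ = 1 := by simp [hQ, altSum_empty]
  have b1 : ∀ r, ∀ S ⊆ A, ‖Φ (D (r + 1) S)‖ ≤ Q (r + 1) S / 2 := by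
    intro r
    induction r with
    | zero =>
      intro S hS
      rw [hDs, hQs, map_sum, Finset.sum_div]
      refine (norm_sum_le _ _).trans (Finset.sum_le_sum fun w hw => ?_)
      rw [hD0 S ⟨w, hw⟩, hQ00 S ⟨w, hw⟩]
      rcases (S.erase w).eq_empty_or_nonempty with h | h
      · rw [h, hD0', hQ0']
        simpa using hΦ1 w (hS hw)
      · simp [hD0 _ h, hQ00 _ h]
    | succ r ih =>
      intro S hS
      rw [hDs, hQs, map_sum, Finset.sum_div]
      refine (norm_sum_le _ _).trans (Finset.sum_le_sum fun w hw => ?_)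
      refine (hΦ w (hS hw) _).trans ?_
      rw [map_add]
      have := norm_add_le (Φ (D (r + 1) S)) (Φ (D (r + 1) (S.erase w)))
      have := ih S hS
      have := ih (S.erase w) ((Finset.erase_subset _ _).trans hS)
      linarith
  have b2 : ∀ r, ‖φ (D (r + 2) A)‖ ≤ Q (r + 2) A / 4 := by
    intro r
    rw [hDs, hQs, map_sum, Finset.sum_div]
    refine (norm_sum_le _ _).trans (Finset.sum_le_sum fun w hw => ?_)
    refine (hφ w hw _).trans ?_
    rw [map_add]
    have := norm_add_le (Φ (D (r + 1) A)) (Φ (D (r + 1) (A.erase w)))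
    have := b1 r A subset_rfl
    have := b1 r (A.erase w) (Finset.erase_subset _ _)
    linarith
  have b3 : φ (D 1 A) = 0 := by
    rw [hDs, map_sum]
    refine Finset.sum_eq_zero fun w hw => ?_
    rw [hD0 A hA]
    rcases (A.erase w).eq_empty_or_nonempty with h | h
    · simp [h, hD0', hφ1 w hw]
    · simp [hD0 _ h]
  have hsum : HasSum (fun r => ((r.factorial : ℂ)⁻¹ * (-t : ℂ) ^ r) * φ (D r A))
      (altSum (fun B => φ (NormedSpace.exp ((-t : ℂ) • ∑ w ∈ B, x w))) A) := by
    have h := hasSum_altSum (fun B => ((NormedSpace.exp_series_hasSum_exp' (𝕂 := ℂ)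
      ((-t : ℂ) • ∑ w ∈ B, x w)).mapL φ)) A
    refine Eq.mpr (congrArg (fun f => HasSum f _) (funext fun r => ?_)) h
    rw [hD, map_altSum, ← AddMonoidHom.coe_mulLeft, map_altSum]
    refine altSum_congr fun B _ => ?_
    rw [smul_pow, smul_smul, map_smul, smul_eq_mul, AddMonoidHom.coe_mulLeft]
  have hsumQ : HasSum (fun r => ((r.factorial : ℝ)⁻¹ * t ^ r) * Q r A)
      ((Real.exp (2 * t) - 1) ^ #A) := by
    rw [← altSum_pow_card]
    have hB : ∀ B : Finset ι, HasSum (fun r : ℕ => (r.factorial : ℝ)⁻¹ * (t * ∑ _w ∈ B, (2 : ℝ)) ^ r)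
        (Real.exp (2 * t) ^ #B) := by
      intro B
      have h := NormedSpace.exp_series_hasSum_exp' (𝕂 := ℝ) (t * ∑ _w ∈ B, (2 : ℝ))
      rw [← Real.exp_eq_exp_ℝ] at h
      have e : Real.exp (2 * t) ^ #B = Real.exp (t * ∑ _w ∈ B, (2 : ℝ)) := by
        rw [← Real.exp_nat_mul]
        simp
        ring_nf
      simpa [e] using h
    refine Eq.mpr (congrArg (fun f => HasSum f _) (funext fun r => ?_)) (hasSum_altSum hB A)
    rw [hQ, ← AddMonoidHom.coe_mulLeft, map_altSum]
    refine altSum_congr fun B _ => ?_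
    simp [mul_pow, mul_assoc]
  have hsumb := (hsumQ.sub (hasSum_ite_eq 1 (t * Q 1 A))).div_const 4
  have hle := hsum.norm_le_of_bounded hsumb fun r => ?_
  · refine hle.trans ?_
    have hQ1 : (if #A = 1 then 2 * t else 0) ≤ t * Q 1 A := by
      split_ifs with h
      · obtain ⟨a, rfl⟩ := Finset.card_eq_one.1 h
        simp [hQ, altSum_singleton, mul_comm]
      · exact mul_nonneg ht (hQ0 _ _)
    linarith
  · match r with
    | 0 => simp [hD0 A hA, hQ00 A hA]
    | 1 => simp [b3]
    | r + 2 =>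
      rw [norm_mul]
      have h1 : ‖((r + 2).factorial : ℂ)⁻¹ * (-t : ℂ) ^ (r + 2)‖ =
          ((r + 2).factorial : ℝ)⁻¹ * t ^ (r + 2) := by
        simp [abs_of_nonneg ht]
      rw [h1]
      have := mul_le_mul_of_nonneg_left (b2 r)
        (by positivity : (0 : ℝ) ≤ ((r + 2).factorial : ℝ)⁻¹ * t ^ (r + 2))
      simpa [mul_div_assoc] using this
end

end Combinatorics

section Constants
open Real

lemma exists_cluster_constants {m : ℕ} (hm : 1 ≤ m) {z : ℝ} (hz : 0 ≤ z)
    (hzm : z * (exp 1 * m ^ 2) ≤ 2) :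
    ∃ β : ℝ, 0 ≤ β ∧ (exp z - 1) * (1 + β) ^ (m - 1) ≤ β ∧
      1 + ((exp z - 1) * (1 + β) ^ m - z) / 4 ≤ exp (exp 1 * m ^ 2 * z ^ 2 / 4) := by
  have he := Real.exp_one_gt_d9
  have he' := Real.exp_one_lt_d9
  have hy0 : 0 ≤ exp z - 1 := by linarith [Real.add_one_le_exp z]
  rcases hm.eq_or_lt with rfl | hm
  · have hz1 : z ≤ 0.736 := by
      norm_num at hzm
      nlinarith
    refine ⟨exp z - 1, hy0, by simp, ?_⟩
    have hy : exp z ≤ 1 + z + z ^ 2 / 2 + z ^ 3 / 6 + z ^ 4 * 5 / 96 := by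
      have := Real.exp_bound' hz (by linarith : z ≤ 1) (n := 4) (by norm_num)
      norm_num [Finset.sum_range_succ, Nat.factorial] at this
      linarith
    set x := exp 1 * ((1 : ℕ) : ℝ) ^ 2 * z ^ 2 / 4 with hx
    have hx0 : 0 ≤ x := by positivity
    have hxl : 2.718 * z ^ 2 / 4 ≤ x := by
      rw [hx]; norm_num; nlinarith [sq_nonneg z]
    have hq := Real.quadratic_le_exp_of_nonneg hx0
    have hq' : 1 + 2.718 * z ^ 2 / 4 + (2.718 * z ^ 2 / 4) ^ 2 / 2 ≤ exp x := by
      refine le_trans ?_ hq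
      gcongr
    refine le_trans ?_ hq'
    have hz2 : z ^ 2 ≤ 0.736 * z := by nlinarith
    have hy1 : exp z - 1 ≤ z + z ^ 2 * (0.5 + 0.206 * z) := by
      nlinarith [mul_nonneg (sq_nonneg z) hz, mul_nonneg (mul_nonneg (sq_nonneg z) hz)
        (sub_nonneg.2 hz1)]
    have hy2 : exp z - 1 ≤ z * (1 + 0.652 * z) := by
      nlinarith [mul_nonneg (sq_nonneg z) (sub_nonneg.2 hz1)]
    have hy3 : (exp z - 1) ^ 2 ≤ (z * (1 + 0.652 * z)) ^ 2 := by gcongr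
    have h4 : 0 ≤ z ^ 2 * (0.736 - z) := mul_nonneg (sq_nonneg z) (sub_nonneg.2 hz1)
    have h5 : (exp z - 1) * (1 + (exp z - 1)) ^ 1 = (exp z - 1) + (exp z - 1) ^ 2 := by ring
    rw [h5]
    nlinarith [sq_nonneg (z ^ 2)]
  · set q := z * (exp 1 * (m : ℝ) ^ 2) with hq
    have hq0 : 0 ≤ q := by positivity
    have hm2 : (2 : ℝ) ≤ m := by exact_mod_cast hm
    have main : (exp z - 1) * (1 + z * (1 + q)) ^ m ≤ z * (1 + q) := by
      rcases (show 2 ≤ m from hm).eq_or_lt with rfl | hm3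
      · have hzq : z ≤ 0.092 * q := by
          rw [hq]; norm_num; nlinarith
        have hz1 : z ≤ 0.184 := by linarith
        have hy : exp z ≤ 1 + z + z ^ 2 / 2 + z ^ 3 * 2 / 9 := by
          have := Real.exp_bound' hz (by linarith : z ≤ 1) (n := 3) (by norm_num)
          norm_num [Finset.sum_range_succ, Nat.factorial] at this
          linarith
        have hy1 : exp z - 1 ≤ z * (1 + 0.05 * q) := by
          have h1 : z ^ 2 ≤ z * (0.092 * q) := by nlinarith
          have h2 : z ^ 3 ≤ 0.184 * z ^ 2 := by nlinarith [sq_nonneg z]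
          nlinarith
        have h3 : 1 + z * (1 + q) ≤ 1 + 0.276 * q := by nlinarith
        have h4 : (1 + 0.05 * q) * (1 + 0.276 * q) ^ 2 ≤ 1 + q := by
          have h5 : 0 ≤ q * (2 - q) := by nlinarith
          have h6 : 0 ≤ q ^ 2 * (2 - q) := by apply mul_nonneg <;> nlinarith
          nlinarith
        calc _ ≤ z * (1 + 0.05 * q) * (1 + 0.276 * q) ^ 2 := by gcongr
          _ = z * ((1 + 0.05 * q) * (1 + 0.276 * q) ^ 2) := by ring
          _ ≤ _ := by gcongr
      · have hm3 : (3 : ℝ) ≤ m := by exact_mod_cast hm3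
        have hy : exp z - 1 ≤ z * exp z := by
          have h1 := Real.add_one_le_exp (-z)
          have h2 : exp (-z) * exp z = 1 := by rw [← Real.exp_add]; simp
          nlinarith [Real.exp_pos z]
        have hx : z + m * (z * (1 + q)) ≤ 0.41 * q := by
          have h1 : 9 * (1 + m * 3) ≤ 10 * (m : ℝ) ^ 2 := by nlinarith
          have h2 : z + m * (z * (1 + q)) ≤ z * (1 + m * 3) := by
            nlinarith [mul_nonneg (mul_nonneg hz (by linarith : (0 : ℝ) ≤ m)) (sub_nonneg.2 hzm)]
          have h3 : z * (1 + m * 3) ≤ z * (10 / 9 * (m : ℝ) ^ 2) := by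
            gcongr
            linarith
          have h4 : 0 ≤ z * (m : ℝ) ^ 2 := by positivity
          have h5 : q = exp 1 * (z * (m : ℝ) ^ 2) := by rw [hq]; ring
          nlinarith
        have h1 : (1 + z * (1 + q)) ^ m ≤ exp (m * (z * (1 + q))) := by
          rw [Real.exp_nat_mul]
          gcongr
          linarith [Real.add_one_le_exp (z * (1 + q))]
        have h2 : exp (0.41 * q) ≤ 1 + q := by
          have := Real.exp_bound' (by positivity : 0 ≤ 0.41 * q) (by linarith) (n := 3)
            (by norm_num)
          norm_num [Finset.sum_range_succ, Nat.factorial] at this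
          have h5 : 0 ≤ q * (2 - q) := by nlinarith
          have h6 : 0 ≤ q ^ 2 * (2 - q) := by apply mul_nonneg <;> nlinarith
          nlinarith
        calc _ ≤ z * exp z * exp (m * (z * (1 + q))) := by gcongr
          _ = z * exp (z + m * (z * (1 + q))) := by rw [Real.exp_add]; ring
          _ ≤ z * exp (0.41 * q) := by gcongr
          _ ≤ _ := by gcongr
    have hb : 0 ≤ z * (1 + q) := by positivity
    refine ⟨z * (1 + q), hb, le_trans ?_ main, ?_⟩
    · gcongr
      · linarith
      · omega
    · have h1 := Real.add_one_le_exp (exp 1 * (m : ℝ) ^ 2 * z ^ 2 / 4)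
      have h2 : z * q = exp 1 * (m : ℝ) ^ 2 * z ^ 2 := by rw [hq]; ring
      linarith

end Constants

section ProductMatrix
open scoped MatrixOrder

lemma prodMatrix_mul (X Y : C → Matrix (Fin d) (Fin d) ℂ) :
    prodMatrix X * prodMatrix Y = prodMatrix fun s => X s * Y s := by
  ext x y
  simp only [Matrix.mul_apply, prodMatrix, Finset.prod_univ_sum, Fintype.piFinset_univ,
    Finset.prod_mul_distrib]

lemma conjTranspose_prodMatrix (X : C → Matrix (Fin d) (Fin d) ℂ) :
    (prodMatrix X)ᴴ = prodMatrix fun s => (X s)ᴴ := by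
  ext x y
  simp [Matrix.conjTranspose_apply, prodMatrix]

lemma trace_prodMatrix (X : C → Matrix (Fin d) (Fin d) ℂ) :
    (prodMatrix X).trace = ∏ s, (X s).trace := by
  simp only [Matrix.trace, Matrix.diag, prodMatrix, Finset.prod_univ_sum, Fintype.piFinset_univ]

lemma exists_prodMatrix_eq_conjTranspose_mul_self {ρs : C → Matrix (Fin d) (Fin d) ℂ}
    (hρs : ∀ s, (ρs s).PosSemidef) : ∃ B, prodMatrix ρs = Bᴴ * B := by
  have h : ∀ s, ∃ B, ρs s = star B * B := fun s =>
    CStarAlgebra.nonneg_iff_eq_star_mul_self.mp (hρs s).nonneg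
  choose B hB using h
  refine ⟨prodMatrix B, ?_⟩
  rw [conjTranspose_prodMatrix, prodMatrix_mul]
  exact congrArg prodMatrix (funext hB)

end ProductMatrix

section Factorization
open scoped Kronecker Matrix.Norms.L2Operator

lemma SupportedOn.sub_smul_one {w : Finset C} {M : Matrix (C → Fin d) (C → Fin d) ℂ}
    (hM : SupportedOn w M) (c : ℂ) : SupportedOn w (M - c • 1) := by
  refine ⟨fun x y hxy s hs => ?_, fun x y x' y' hx hy ho ho' => ?_⟩
  · by_contra hne
    have h1 : x ≠ y := fun h => hne (congrFun h s)
    exact hne (hM.1 x y (by simpa [Matrix.one_apply, h1] using hxy) s hs)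
  · have h1 : x = y ↔ x' = y' := by
      constructor <;> intro h <;> ext s <;> by_cases hs : s ∈ w
      · rw [← hx s hs, ← hy s hs, h]
      · rw [ho' s hs]
      · rw [hx s hs, hy s hs, h]
      · rw [ho s hs]
    simp only [Matrix.sub_apply, Matrix.smul_apply, Matrix.one_apply, h1, hM.2 x y x' y' hx hy ho ho']

variable (d) in
/-- Operators acting on the sites satisfying `p`, as operators on all sites. -/
def leftFactor (p : C → Prop) [DecidablePred p] :
    Matrix ({s // p s} → Fin d) ({s // p s} → Fin d) ℂ →ₐ[ℂ]
      Matrix (C → Fin d) (C → Fin d) ℂ :=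
  AlgHom.ofLinearMap
    { toFun := fun X => (X ⊗ₖ (1 : Matrix ({s // ¬ p s} → Fin d) _ ℂ)).submatrix
        (Equiv.piEquivPiSubtypeProd p fun _ => Fin d)
        (Equiv.piEquivPiSubtypeProd p fun _ => Fin d)
      map_add' := fun X Y => by rw [add_kronecker]; rfl
      map_smul' := fun c X => by rw [smul_kronecker]; rfl }
    (by simp)
    (fun X Y => by
      simp only [LinearMap.coe_mk, AddHom.coe_mk]
      rw [submatrix_mul_equiv, ← mul_kronecker_mul, one_mul])

variable (d) in
/-- Operators acting on the sites not satisfying `p`, as operators on all sites. -/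
def rightFactor (p : C → Prop) [DecidablePred p] :
    Matrix ({s // ¬ p s} → Fin d) ({s // ¬ p s} → Fin d) ℂ →ₐ[ℂ]
      Matrix (C → Fin d) (C → Fin d) ℂ :=
  AlgHom.ofLinearMap
    { toFun := fun X => ((1 : Matrix ({s // p s} → Fin d) _ ℂ) ⊗ₖ X).submatrix
        (Equiv.piEquivPiSubtypeProd p fun _ => Fin d)
        (Equiv.piEquivPiSubtypeProd p fun _ => Fin d)
      map_add' := fun X Y => by rw [kronecker_add]; rfl
      map_smul' := fun c X => by rw [kronecker_smul]; rfl }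
    (by simp)
    (fun X Y => by
      simp only [LinearMap.coe_mk, AddHom.coe_mk]
      rw [submatrix_mul_equiv, ← mul_kronecker_mul, one_mul])

lemma leftFactor_apply (p : C → Prop) [DecidablePred p] (X) : leftFactor d p X =
    (X ⊗ₖ (1 : Matrix ({s // ¬ p s} → Fin d) _ ℂ)).submatrix
      (Equiv.piEquivPiSubtypeProd p fun _ => Fin d)
      (Equiv.piEquivPiSubtypeProd p fun _ => Fin d) := rfl

lemma rightFactor_apply (p : C → Prop) [DecidablePred p] (X) : rightFactor d p X =
    ((1 : Matrix ({s // p s} → Fin d) _ ℂ) ⊗ₖ X).submatrix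
      (Equiv.piEquivPiSubtypeProd p fun _ => Fin d)
      (Equiv.piEquivPiSubtypeProd p fun _ => Fin d) := rfl

lemma leftFactor_mul_rightFactor (p : C → Prop) [DecidablePred p] (X Y) :
    leftFactor d p X * rightFactor d p Y = (X ⊗ₖ Y).submatrix
      (Equiv.piEquivPiSubtypeProd p fun _ => Fin d)
      (Equiv.piEquivPiSubtypeProd p fun _ => Fin d) := by
  rw [leftFactor_apply, rightFactor_apply, submatrix_mul_equiv, ← mul_kronecker_mul, one_mul,
    mul_one]

lemma commute_leftFactor_rightFactor (p : C → Prop) [DecidablePred p] (X Y) :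
    Commute (leftFactor d p X) (rightFactor d p Y) := by
  rw [Commute, SemiconjBy, leftFactor_mul_rightFactor, leftFactor_apply, rightFactor_apply,
    submatrix_mul_equiv, ← mul_kronecker_mul, one_mul, mul_one]

lemma prodMatrix_eq_kronecker (p : C → Prop) [DecidablePred p]
    (ρs : C → Matrix (Fin d) (Fin d) ℂ) :
    prodMatrix ρs = (prodMatrix (fun s : {s // p s} => ρs s) ⊗ₖ
      prodMatrix (fun s : {s // ¬ p s} => ρs s)).submatrix
      (Equiv.piEquivPiSubtypeProd p fun _ => Fin d)
      (Equiv.piEquivPiSubtypeProd p fun _ => Fin d) := by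
  ext x y
  simp only [prodMatrix, submatrix_apply, kroneckerMap_apply, Equiv.piEquivPiSubtypeProd_apply]
  exact (Fintype.prod_subtype_mul_prod_subtype p fun s => ρs s (x s) (y s)).symm

lemma trace_prodMatrix_mul_factor (p : C → Prop) [DecidablePred p]
    {ρs : C → Matrix (Fin d) (Fin d) ℂ} (hρs : ∀ s, (ρs s).trace = 1) (X Y) :
    (prodMatrix ρs * (leftFactor d p X * rightFactor d p Y)).trace =
      (prodMatrix ρs * leftFactor d p X).trace * (prodMatrix ρs * rightFactor d p Y).trace := by
  have key : ∀ X Y, (prodMatrix ρs * (leftFactor d p X * rightFactor d p Y)).trace =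
      (prodMatrix (fun s : {s // p s} => ρs s) * X).trace *
        (prodMatrix (fun s : {s // ¬ p s} => ρs s) * Y).trace := fun X Y => by
    rw [leftFactor_mul_rightFactor, prodMatrix_eq_kronecker p ρs, submatrix_mul_equiv,
      ← mul_kronecker_mul, ← trace_kronecker]
    exact Equiv.sum_comp (Equiv.piEquivPiSubtypeProd p fun _ => Fin d)
      fun i => ((_ : Matrix _ _ ℂ) ⊗ₖ (_ : Matrix _ _ ℂ)) i i
  have h1 := key X 1
  have h2 := key 1 Y
  rw [map_one, mul_one] at h1
  rw [map_one, one_mul] at h2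
  rw [key, h1, h2]
  simp [trace_prodMatrix, hρs]

lemma SupportedOn.mem_range_leftFactor {w : Finset C} {M : Matrix (C → Fin d) (C → Fin d) ℂ}
    (hM : SupportedOn w M) (p : C → Prop) [DecidablePred p] (hp : ∀ s ∈ w, p s) :
    M ∈ (leftFactor d p).range := by
  rcases isEmpty_or_nonempty (C → Fin d) with hE | ⟨⟨z⟩⟩
  · exact ⟨0, Subsingleton.elim _ _⟩
  let e := Equiv.piEquivPiSubtypeProd p fun _ : C => Fin d
  refine ⟨M.submatrix (fun x => e.symm (x, fun s => z s)) fun y => e.symm (y, fun s => z s), ?_⟩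
  ext x y
  rw [AlgHom.toRingHom_eq_coe, RingHom.coe_coe, leftFactor_apply, submatrix_apply,
    kroneckerMap_apply]
  simp only [e, submatrix_apply, Equiv.piEquivPiSubtypeProd_apply, Matrix.one_apply]
  by_cases h : ∀ s ∉ w, x s = y s
  · rw [if_pos (funext fun s : {s // ¬ p s} => h s fun hs => s.2 (hp s hs)), mul_one]
    refine hM.2 _ _ _ _ ?_ ?_ ?_ h
    · intro s hs; simp [hp s hs]
    · intro s hs; simp [hp s hs]
    · intro s hs; by_cases hw : p s <;> simp [hw, h s hs]
  · have hxy : M x y = 0 := by_contra fun hc => h (hM.1 x y hc)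
    rw [hxy]
    split_ifs with h1
    · rw [mul_one]
      by_contra hc
      refine h fun s hs => ?_
      by_cases hw : p s
      · simpa [hw] using hM.1 _ _ hc s hs
      · exact congrFun h1 ⟨s, hw⟩
    · rw [mul_zero]

lemma SupportedOn.mem_range_rightFactor {w : Finset C}
    {M : Matrix (C → Fin d) (C → Fin d) ℂ} (hM : SupportedOn w M) (p : C → Prop)
    [DecidablePred p] (hp : ∀ s ∈ w, ¬ p s) : M ∈ (rightFactor d p).range := by
  rcases isEmpty_or_nonempty (C → Fin d) with hE | ⟨⟨z⟩⟩
  · exact ⟨0, Subsingleton.elim _ _⟩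
  let e := Equiv.piEquivPiSubtypeProd p fun _ : C => Fin d
  refine ⟨M.submatrix (fun x => e.symm (fun s => z s, x)) fun y => e.symm (fun s => z s, y), ?_⟩
  ext x y
  rw [AlgHom.toRingHom_eq_coe, RingHom.coe_coe, rightFactor_apply, submatrix_apply,
    kroneckerMap_apply]
  simp only [e, submatrix_apply, Equiv.piEquivPiSubtypeProd_apply, Matrix.one_apply]
  by_cases h : ∀ s ∉ w, x s = y s
  · rw [if_pos (funext fun s : {s // p s} => h s fun hs => hp s hs s.2), one_mul]
    refine hM.2 _ _ _ _ ?_ ?_ ?_ h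
    · intro s hs; simp [hp s hs]
    · intro s hs; simp [hp s hs]
    · intro s hs; by_cases hw : p s <;> simp [hw, h s hs]
  · have hxy : M x y = 0 := by_contra fun hc => h (hM.1 x y hc)
    rw [hxy]
    split_ifs with h1
    · rw [one_mul]
      by_contra hc
      refine h fun s hs => ?_
      by_cases hw : p s
      · exact congrFun h1 ⟨s, hw⟩
      · simpa [hw] using hM.1 _ _ hc s hs
    · rw [zero_mul]

lemma exp_mem_of_mem_subalgebra {n : Type*} [Fintype n] [DecidableEq n]
    (S : Subalgebra ℂ (Matrix n n ℂ)) {X : Matrix n n ℂ} (hX : X ∈ S) :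
    NormedSpace.exp X ∈ S := by
  have hS : IsClosed (S : Set (Matrix n n ℂ)) :=
    Submodule.closed_of_finiteDimensional (Subalgebra.toSubmodule S)
  exact NormedSpace.exp_mem hS hX

lemma trace_prodMatrix_mul_exp_add {A S : Finset (Finset C)}
    {g : Finset C → Matrix (C → Fin d) (C → Fin d) ℂ} 
    (hgA : ∀ w ∈ A, SupportedOn w (g w)) (hgS : ∀ w ∈ S, SupportedOn w (g w))
    (hAS : ∀ v ∈ A, ∀ w ∈ S, Disjoint v w)
    {ρs : C → Matrix (Fin d) (Fin d) ℂ} (hρs : ∀ s, (ρs s).trace = 1) (c : ℂ) :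
    (prodMatrix ρs * NormedSpace.exp (c • (∑ w ∈ A, g w + ∑ w ∈ S, g w))).trace =
      (prodMatrix ρs * NormedSpace.exp (c • ∑ w ∈ A, g w)).trace *
      (prodMatrix ρs * NormedSpace.exp (c • ∑ w ∈ S, g w)).trace := by
  classical
  let p : C → Prop := fun s => ∃ v ∈ A, s ∈ v
  have hA : c • ∑ w ∈ A, g w ∈ (leftFactor d p).range :=
    Subalgebra.smul_mem _ (Subalgebra.sum_mem _ fun w hw =>
      (hgA w hw).mem_range_leftFactor p fun s hs => ⟨w, hw, hs⟩) c
  have hS : c • ∑ w ∈ S, g w ∈ (rightFactor d p).range :=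
    Subalgebra.smul_mem _ (Subalgebra.sum_mem _ fun w hw =>
      (hgS w hw).mem_range_rightFactor p fun s hs ⟨v, hv, hsv⟩ =>
        Finset.disjoint_left.1 (hAS v hv w hw) hsv hs) c
  have hc : Commute (c • ∑ w ∈ A, g w) (c • ∑ w ∈ S, g w) := by
    obtain ⟨X, hX⟩ := hA
    obtain ⟨Y, hY⟩ := hS
    rw [← hX, ← hY]
    exact commute_leftFactor_rightFactor _ X Y
  rw [smul_add, Matrix.exp_add_of_commute _ _ hc]
  obtain ⟨X, hX⟩ := exp_mem_of_mem_subalgebra _ hA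
  obtain ⟨Y, hY⟩ := exp_mem_of_mem_subalgebra _ hS
  rw [← hX, ← hY]
  exact trace_prodMatrix_mul_factor _ hρs X Y

end Factorization

section GNS
open scoped Matrix.Norms.L2Operator InnerProductSpace

variable {n : Type*} [Fintype n] [DecidableEq n]

/-- The vector of the operator `A` in the representation of matrices on the
Hilbert–Schmidt space, with cyclic vector given by `Bᴴ`. -/
def gnsVector (B : Matrix n n ℂ) : Matrix n n ℂ →ₗ[ℂ] EuclideanSpace ℂ (n × n) where
  toFun A := WithLp.toLp 2 fun p => (A * Bᴴ) p.1 p.2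
  map_add' X Y := by ext p; simp [add_mul]
  map_smul' c X := by ext p; simp

lemma gnsVector_apply (B A : Matrix n n ℂ) (p : n × n) :
    gnsVector B A p = (A * Bᴴ) p.1 p.2 := rfl

lemma inner_gnsVector (B X Y : Matrix n n ℂ) :
    ⟪gnsVector B X, gnsVector B Y⟫_ℂ = (Bᴴ * B * (Xᴴ * Y)).trace := by
  have h : (Bᴴ * B * (Xᴴ * Y)).trace = ((X * Bᴴ)ᴴ * (Y * Bᴴ)).trace := by
    rw [mul_assoc, Matrix.trace_mul_comm, conjTranspose_mul, conjTranspose_conjTranspose]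
    simp only [mul_assoc]
  rw [h, PiLp.inner_apply, Fintype.sum_prod_type_right]
  simp only [Matrix.trace, Matrix.diag, Matrix.mul_apply (M := (X * Bᴴ)ᴴ), conjTranspose_apply,
    gnsVector_apply]
  refine Finset.sum_congr rfl fun j _ => Finset.sum_congr rfl fun i _ => ?_
  rw [RCLike.inner_apply, mul_comm]
  rfl

lemma norm_gnsVector_mul_le (B A X : Matrix n n ℂ) :
    ‖gnsVector B (A * X)‖ ≤ ‖A‖ * ‖gnsVector B X‖ := by
  refine le_of_sq_le_sq ?_ (by positivity)
  rw [mul_pow, EuclideanSpace.norm_sq_eq, EuclideanSpace.norm_sq_eq, Fintype.sum_prod_type_right,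
    Fintype.sum_prod_type_right, Finset.mul_sum]
  refine Finset.sum_le_sum fun j _ => ?_
  have h := Matrix.l2_opNorm_mulVec A (WithLp.toLp 2 fun i => (X * Bᴴ) i j)
  have h2 := pow_le_pow_left₀ (norm_nonneg _) h 2
  rw [mul_pow, EuclideanSpace.norm_sq_eq, EuclideanSpace.norm_sq_eq] at h2
  simp only [gnsVector_apply, mul_assoc]
  exact h2

lemma trace_mul_eq_inner_gnsVector {ρ B : Matrix n n ℂ} (hB : ρ = Bᴴ * B) (X : Matrix n n ℂ) :
    (ρ * X).trace = ⟪gnsVector B 1, gnsVector B X⟫_ℂ := by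
  rw [inner_gnsVector, ← hB, conjTranspose_one, one_mul]

lemma norm_gnsVector_one {ρ B : Matrix n n ℂ} (hB : ρ = Bᴴ * B) (hρ : ρ.trace = 1) :
    ‖gnsVector B 1‖ = 1 := by
  have h1 : ⟪gnsVector B 1, gnsVector B 1⟫_ℂ = 1 := by
    rw [← trace_mul_eq_inner_gnsVector hB, mul_one, hρ]
  rw [inner_self_eq_norm_sq_to_K] at h1
  have h2 : ‖gnsVector B 1‖ ^ 2 = 1 := Complex.ofReal_injective (by simpa using h1)
  nlinarith [norm_nonneg (gnsVector B 1)]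

lemma norm_trace_mul_le {ρ B : Matrix n n ℂ} (hB : ρ = Bᴴ * B) (hρ : ρ.trace = 1)
    (X : Matrix n n ℂ) : ‖(ρ * X).trace‖ ≤ ‖X‖ := by
  have hu := norm_gnsVector_one hB hρ
  rw [trace_mul_eq_inner_gnsVector hB]
  refine (norm_inner_le_norm _ _).trans ?_
  rw [hu, one_mul]
  simpa [hu] using norm_gnsVector_mul_le B X 1

lemma trace_mul_conj {ρ h : Matrix n n ℂ} (hρ : ρ.IsHermitian) (hh : h.IsHermitian) :
    star (ρ * h).trace = (ρ * h).trace := by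
  rw [← Matrix.trace_conjTranspose, conjTranspose_mul, hρ.eq, hh.eq, Matrix.trace_mul_comm]

lemma norm_sub_inner_smul_le {E : Type*} [NormedAddCommGroup E] [InnerProductSpace ℂ E] {u : E}
    (hu : ‖u‖ = 1) (v : E) : ‖v - ⟪u, v⟫_ℂ • u‖ ≤ ‖v‖ := by
  have h0 : ⟪v - ⟪u, v⟫_ℂ • u, ⟪u, v⟫_ℂ • u⟫_ℂ = 0 := by
    have h1 : ⟪u, v - ⟪u, v⟫_ℂ • u⟫_ℂ = 0 := by
      rw [inner_sub_right, inner_smul_right, inner_self_eq_norm_sq_to_K, hu]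
      simp
    rw [inner_smul_right, ← inner_conj_symm (v - ⟪u, v⟫_ℂ • u) u, h1, map_zero, mul_zero]
  have h2 := norm_add_sq_eq_norm_sq_add_norm_sq_of_inner_eq_zero _ _ h0
  rw [sub_add_cancel] at h2
  nlinarith [norm_nonneg v, norm_nonneg (v - ⟪u, v⟫_ℂ • u), norm_nonneg (⟪u, v⟫_ℂ • u)]

theorem norm_altSum_trace_exp_le {ι : Type*} [DecidableEq ι] {ρ B : Matrix n n ℂ}
    (hB : ρ = Bᴴ * B) (hρ : ρ.trace = 1) (h : ι → Matrix n n ℂ) {A : Finset ι} (hA : A.Nonempty)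
    (hherm : ∀ w ∈ A, (h w).IsHermitian) (hnorm : ∀ w ∈ A, ‖h w‖ ≤ 1) {t : ℝ} (ht : 0 ≤ t) :
    ‖altSum (fun S => (ρ * NormedSpace.exp ((-t : ℂ) •
        ∑ w ∈ S, (h w - (ρ * h w).trace • (1 : Matrix n n ℂ)))).trace) A‖ ≤
      ((Real.exp (2 * t) - 1) ^ A.card - if A.card = 1 then 2 * t else 0) / 4 := by
  let φ : Matrix n n ℂ →L[ℂ] ℂ := LinearMap.toContinuousLinearMap
    ((Matrix.traceLinearMap n ℂ ℂ).comp (LinearMap.mulLeft ℂ ρ))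
  have hφ : ∀ X, φ X = (ρ * X).trace := fun X => rfl
  have hφ1 : ∀ X, φ X = ⟪gnsVector B 1, gnsVector B X⟫_ℂ := trace_mul_eq_inner_gnsVector hB
  have hρh : ρ.IsHermitian := hB ▸ isHermitian_conjTranspose_mul_self B
  have hu := norm_gnsVector_one hB hρ
  have hΦh : ∀ w ∈ A, ∀ X, ‖gnsVector B (h w * X)‖ ≤ ‖gnsVector B X‖ := fun w hw X =>
    (norm_gnsVector_mul_le B _ X).trans (mul_le_of_le_one_left (norm_nonneg _) (hnorm w hw))
  have hΦh1 : ∀ w ∈ A, ‖gnsVector B (h w)‖ ≤ 1 := fun w hw => by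
    simpa [hu] using hΦh w hw 1
  have hc : ∀ w ∈ A, ‖(ρ * h w).trace‖ ≤ 1 := fun w hw =>
    (norm_trace_mul_le hB hρ _).trans (hnorm w hw)
  have hg1 : ∀ w ∈ A, ‖gnsVector B (h w - (ρ * h w).trace • 1)‖ ≤ 1 := fun w hw => by
    rw [map_sub, map_smul, ← hφ, hφ1]
    exact (norm_sub_inner_smul_le hu _).trans (hΦh1 w hw)
  refine norm_altSum_exp_le (gnsVector B) φ (fun w => h w - (ρ * h w).trace • 1) hA ?_ ?_ hg1 ?_ ht
  · intro w hw
    rw [map_sub, map_smul, hφ, hφ, mul_one, hρ]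
    simp
  · intro w hw X
    have hgh : (h w - (ρ * h w).trace • (1 : Matrix n n ℂ))ᴴ = h w - (ρ * h w).trace • 1 := by
      rw [conjTranspose_sub, conjTranspose_smul, (hherm w hw).eq, conjTranspose_one,
        trace_mul_conj hρh (hherm w hw)]
    have h1 : φ ((h w - (ρ * h w).trace • 1) * X) =
        ⟪gnsVector B (h w - (ρ * h w).trace • 1), gnsVector B X⟫_ℂ := by
      rw [inner_gnsVector, hgh, ← hB, hφ]
    rw [h1]
    exact (norm_inner_le_norm _ _).trans (mul_le_of_le_one_left (norm_nonneg _) (hg1 w hw))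
  · intro w hw X
    rw [sub_mul, smul_mul_assoc, one_mul, map_sub, map_smul]
    refine (norm_sub_le _ _).trans ?_
    rw [norm_smul]
    have h1 := hΦh w hw X
    have h2 := mul_le_of_le_one_left (norm_nonneg (gnsVector B X)) (hc w hw)
    linarith

end GNS

section SpectralTail
open scoped Matrix.Norms.L2Operator

variable {n : Type*} [Fintype n] [DecidableEq n]

lemma trace_mul_conj_diagonal (ρ U V : Matrix n n ℂ) (v : n → ℂ) :
    (ρ * (U * diagonal v * V)).trace = ∑ i, (V * ρ * U) i i * v i := by
  rw [← mul_assoc, Matrix.trace_mul_comm, ← mul_assoc, ← mul_assoc]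
  simp [Matrix.trace, Matrix.mul_diagonal]

theorem trace_mul_projLE_le {ρ H : Matrix n n ℂ} (hρ : ρ.PosSemidef) (hH : H.IsHermitian)
    {τ : ℝ} (hτ : 0 ≤ τ) (f c : ℝ) :
    (ρ * projLE hH f).trace.re ≤ Real.exp (τ * (f - c)) *
      (ρ * NormedSpace.exp ((-τ : ℂ) • (H - (c : ℂ) • 1))).trace.re := by
  set U := hH.eigenvectorUnitary with hU
  have hUU : (U : Matrix n n ℂ) * (star U : Matrix n n ℂ) = 1 := Unitary.coe_mul_star_self U
  have hexp : NormedSpace.exp ((-τ : ℂ) • (H - (c : ℂ) • 1)) = (U : Matrix n n ℂ) *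
      diagonal (fun i => ((Real.exp (-τ * (hH.eigenvalues i - c)) : ℝ) : ℂ)) *
      (star U : Matrix n n ℂ) := by
    have h1 : (-τ : ℂ) • (H - (c : ℂ) • 1) = (U : Matrix n n ℂ) *
        diagonal (fun i => ((-τ * (hH.eigenvalues i - c) : ℝ) : ℂ)) * (star U : Matrix n n ℂ) := by
      have h2 : diagonal (fun i => ((-τ * (hH.eigenvalues i - c) : ℝ) : ℂ)) =
          (-τ : ℂ) • (diagonal (RCLike.ofReal ∘ hH.eigenvalues) - (c : ℂ) • (1 : Matrix n n ℂ)) := by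
        ext i j
        by_cases hij : i = j <;> simp [hij]
      rw [h2, mul_smul_comm, smul_mul_assoc, mul_sub, sub_mul, mul_smul_comm, smul_mul_assoc,
        mul_one, hUU]
      congr 2
      exact hH.spectral_theorem
    rw [h1]
    have h3 := Matrix.exp_units_conj (Unitary.toUnits U)
      (diagonal (fun i => ((-τ * (hH.eigenvalues i - c) : ℝ) : ℂ)))
    rw [Matrix.exp_diagonal] at h3
    refine h3.trans ?_
    congr 3
    ext i
    rw [Pi.coe_exp, ← Complex.exp_eq_exp_ℂ, Complex.ofReal_exp]
  have hq : ∀ i, 0 ≤ ((star U : Matrix n n ℂ) * ρ * (U : Matrix n n ℂ)) i i := fun i =>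
    (hρ.conjTranspose_mul_mul_same (U : Matrix n n ℂ)).diag_nonneg
  rw [hexp, projLE, trace_mul_conj_diagonal, trace_mul_conj_diagonal, Complex.re_sum,
    Complex.re_sum, Finset.mul_sum]
  refine Finset.sum_le_sum fun i _ => ?_
  have hq' := (Complex.le_def.1 (hq i)).1
  rw [Complex.zero_re] at hq'
  rw [Complex.re_mul_ofReal, mul_left_comm, ← Real.exp_add]
  split_ifs with hi
  · rw [mul_one]
    refine le_mul_of_one_le_right hq' (Real.one_le_exp ?_)
    nlinarith
  · rw [mul_zero, Complex.zero_re]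
    positivity

lemma abs_eigenvalues_le_norm {H : Matrix n n ℂ} (hH : H.IsHermitian) (i : n) :
    |hH.eigenvalues i| ≤ ‖H‖ := by
  have h := Matrix.l2_opNorm_mulVec H (hH.eigenvectorBasis i)
  rw [hH.mulVec_eigenvectorBasis, hH.eigenvectorBasis.orthonormal.1 i, mul_one] at h
  rw [show (EuclideanSpace.equiv n ℂ).symm (hH.eigenvalues i • ⇑(hH.eigenvectorBasis i)) =
    hH.eigenvalues i • hH.eigenvectorBasis i from rfl, norm_smul,
    hH.eigenvectorBasis.orthonormal.1 i, mul_one] at h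
  exact h

lemma projLE_eq_zero {H : Matrix n n ℂ} (hH : H.IsHermitian) {f : ℝ} (hf : f < -‖H‖) :
    projLE hH f = 0 := by
  have h : (fun i => if hH.eigenvalues i ≤ f then (1 : ℂ) else 0) = 0 := funext fun i =>
    if_neg fun hi => by
      have := neg_le_of_abs_le (abs_eigenvalues_le_norm hH i)
      linarith
  rw [projLE, h]
  simp

end SpectralTail

section ClusterExpansion
open scoped Matrix.Norms.L2Operator

theorem norm_trace_prodMatrix_mul_exp_le (W : Finset (Finset C)) {m : ℕ} (hm1 : 1 ≤ m)
    (hm : ∀ w ∈ W, (W.filter (fun w' => w' ≠ w ∧ (w ∩ w').Nonempty)).card ≤ m)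
    (h : Finset C → Matrix (C → Fin d) (C → Fin d) ℂ)
    (hsupp : ∀ w ∈ W, SupportedOn w (h w)) (hherm : ∀ w ∈ W, (h w).IsHermitian)
    (hnorm : ∀ w ∈ W, ‖h w‖ ≤ 1) (ρs : C → Matrix (Fin d) (Fin d) ℂ)
    (hρs : ∀ s, (ρs s).PosSemidef ∧ (ρs s).trace = 1)
    {t : ℝ} (ht : 0 ≤ t) (htm : 2 * t * (Real.exp 1 * m ^ 2) ≤ 2) :
    ‖(prodMatrix ρs * NormedSpace.exp ((-t : ℂ) •
        ∑ w ∈ W, (h w - (prodMatrix ρs * h w).trace • 1))).trace‖ ≤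
      Real.exp (Real.exp 1 * m ^ 2 * (2 * t) ^ 2 / 4) ^ W.card := by
  have hz : 0 ≤ 2 * t := by positivity
  obtain ⟨β, hβ, hβ1, hβ2⟩ := exists_cluster_constants hm1 hz htm
  obtain ⟨B, hB⟩ := exists_prodMatrix_eq_conjTranspose_mul_self fun s => (hρs s).1
  have htr : (prodMatrix ρs).trace = 1 := by simp [trace_prodMatrix, hρs]
  refine norm_le_pow_card_of_altSum_le
    (fun S => (prodMatrix ρs * NormedSpace.exp ((-t : ℂ) •
        ∑ w ∈ S, (h w - (prodMatrix ρs * h w).trace • 1))).trace)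
    (fun w w' => w' ≠ w ∧ (w ∩ w').Nonempty) ?_ W m hm ?_ ?_ hz ?_ hβ
    (Real.one_le_exp (by positivity)) hβ1 hβ2 ?_ subset_rfl
  · rintro a b ⟨hab, hi⟩
    exact ⟨hab.symm, by rwa [Finset.inter_comm]⟩
  · simp [htr]
  · intro A hA S hS hAS hadj
    simp only [Finset.sum_union hAS]
    refine trace_prodMatrix_mul_exp_add (fun w hw => (hsupp w (hA hw)).sub_smul_one _)
      (fun w hw => (hsupp w (hS hw)).sub_smul_one _) (fun v hv w hw => ?_) (fun s => (hρs s).2) _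
    by_contra hc
    refine hadj v hv w hw ⟨?_, Finset.nonempty_iff_ne_empty.2 fun h0 =>
      hc (Finset.disjoint_iff_inter_eq_empty.2 h0)⟩
    rintro rfl
    exact Finset.disjoint_left.1 hAS hv hw
  · linarith [Real.add_one_le_exp (2 * t)]
  · intro A hA hne
    exact norm_altSum_trace_exp_le hB htr h hne (fun w hw => hherm w (hA hw))
      (fun w hw => hnorm w (hA hw)) ht

theorem trace_prodMatrix_mul_projLE_le (W : Finset (Finset C)) (hW : W.Nonempty) (m : ℕ)
    (hm : ∀ w ∈ W, (W.filter (fun w' => w' ≠ w ∧ (w ∩ w').Nonempty)).card ≤ m)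
    (h : Finset C → Matrix (C → Fin d) (C → Fin d) ℂ)
    (hsupp : ∀ w ∈ W, SupportedOn w (h w)) (hherm : ∀ w ∈ W, (h w).IsHermitian)
    (hnorm : ∀ w ∈ W, ‖h w‖ ≤ 1) (ρs : C → Matrix (Fin d) (Fin d) ℂ)
    (hρs : ∀ s, (ρs s).PosSemidef ∧ (ρs s).trace = 1)
    (hH : (∑ w ∈ W, h w).IsHermitian) {a : ℝ} (ha : 0 ≤ a) :
    (prodMatrix ρs *
        projLE hH ((prodMatrix ρs * ∑ w ∈ W, h w).trace.re - W.card * a)).trace.re ≤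
      Real.exp (-(W.card * a ^ 2) / (4 * Real.exp 1 * m ^ 2)) := by
  obtain ⟨B, hB⟩ := exists_prodMatrix_eq_conjTranspose_mul_self fun s => (hρs s).1
  have hρ : (prodMatrix ρs).PosSemidef := hB ▸ posSemidef_conjTranspose_mul_self B
  have htr : (prodMatrix ρs).trace = 1 := by simp [trace_prodMatrix, hρs]
  have hn : (0 : ℝ) < W.card := Nat.cast_pos.2 hW.card_pos
  have hHn : ‖∑ w ∈ W, h w‖ ≤ W.card := by
    refine (norm_sum_le _ _).trans ((Finset.sum_le_sum hnorm).trans ?_)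
    simp
  set H := ∑ w ∈ W, h w with hHdef
  set ρ := prodMatrix ρs with hρdef
  have hEle : (ρ * H).trace.re ≤ W.card := by
    refine (Complex.re_le_norm _).trans (le_trans ?_ hHn)
    exact norm_trace_mul_le hB htr H
  rcases Nat.eq_zero_or_pos m with rfl | hm1
  · have h0 := trace_mul_projLE_le hρ hH le_rfl ((ρ * H).trace.re - W.card * a) 0
    simpa [htr] using h0
  rcases lt_or_ge 2 a with ha2 | ha2
  · rw [projLE_eq_zero hH (by nlinarith)]
    simp only [mul_zero, Matrix.trace_zero, Complex.zero_re]
    positivity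
  have hm0 : (0 : ℝ) < m := Nat.cast_pos.2 hm1
  have he : 0 < Real.exp 1 * m ^ 2 := by positivity
  have ht : 0 ≤ a / (2 * (Real.exp 1 * m ^ 2)) := by positivity
  set t := a / (2 * (Real.exp 1 * m ^ 2)) with htdef
  have htm : 2 * t * (Real.exp 1 * m ^ 2) = a := by
    rw [htdef]
    field_simp
  have hbound := norm_trace_prodMatrix_mul_exp_le W hm1 hm h hsupp hherm hnorm ρs hρs ht
    (htm.le.trans ha2)
  have hcoe : (((ρ * H).trace.re : ℝ) : ℂ) = (ρ * H).trace :=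
    Complex.conj_eq_iff_re.1 (trace_mul_conj hρ.isHermitian hH)
  have hsum : ∑ w ∈ W, (h w - (ρ * h w).trace • (1 : Matrix (C → Fin d) (C → Fin d) ℂ)) =
      H - (((ρ * H).trace.re : ℝ) : ℂ) • 1 := by
    rw [hcoe, hHdef, Finset.sum_sub_distrib, ← Finset.sum_smul, Finset.mul_sum, Matrix.trace_sum]
  rw [← hρdef, hsum] at hbound
  refine (trace_mul_projLE_le hρ hH ht _ (ρ * H).trace.re).trans ?_
  refine (mul_le_mul_of_nonneg_left ((Complex.re_le_norm _).trans hbound)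
    (Real.exp_pos _).le).trans (le_of_eq ?_)
  rw [← Real.exp_nat_mul, ← Real.exp_add]
  congr 1
  rw [htdef]
  field_simp
  ring

end ClusterExpansion

/-- Theorem 5.3, lower tail (quantum Chernoff bound for product states):
for `a ≥ √(8em²/n)`, `Tr(ρ Π_{≤ ⟨H⟩_ρ − na}) ≤ exp(−na²/(4em²))`. -/
theorem product_state_lower_tail {C : Type*} [Fintype C] [DecidableEq C] {d : ℕ}
    (W : Finset (Finset C)) (n : ℕ) (hn : W.card = n) (hnpos : 0 < n) (m : ℕ)
    (hm : ∀ w ∈ W, (W.filter (fun w' => w' ≠ w ∧ (w ∩ w').Nonempty)).card ≤ m)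
    (h : Finset C → Matrix (C → Fin d) (C → Fin d) ℂ)
    (hsupp : ∀ w ∈ W, SupportedOn w (h w))
    (hherm : ∀ w ∈ W, (h w).IsHermitian)
    (hnorm : ∀ w ∈ W, opNorm (h w) ≤ 1)
    (ρs : C → Matrix (Fin d) (Fin d) ℂ)
    (hρs : ∀ s, (ρs s).PosSemidef ∧ (ρs s).trace = 1)
    (hH : (∑ w ∈ W, h w).IsHermitian)
    (a : ℝ) (ha : Real.sqrt (8 * Real.exp 1 * m ^ 2 / n) ≤ a) :
    (Matrix.trace (prodMatrix ρs *
        projLE hH ((Matrix.trace (prodMatrix ρs * ∑ w ∈ W, h w)).re - n * a))).re ≤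
      Real.exp (-(n * a ^ 2) / (4 * Real.exp 1 * m ^ 2)) := by
  subst hn
  exact trace_prodMatrix_mul_projLE_le W (Finset.card_pos.1 hnpos) m hm h hsupp hherm hnorm ρs hρs
    hH ((Real.sqrt_nonneg _).trans ha)
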